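/- Case 9 of Theorem 1.2 (a ℚ-rank one case): the hypergeometric group Γ(f,g) generated by the companion matrices A and B of f(x) = x^5 + x^3 - x^2 - 1 and g(x) = x^5 + x^4 - x^3 - x^2 + x + 1 is an arithmetic subgroup of the integral orthogonal group O_Q(ℤ): Γ(f,g) is contained in O_Q(ℤ) (in particular Aᵀ·Q·A = Q and Bᵀ·Q·B = Q), and Γ(f,g) has finite index in O_Q(ℤ). -/

import Mathlib

open Matrix

/-- The companion matrix `A` of `f(x) = x^5 + x^3 - x^2 - 1`. -/
def matA : Matrix (Fin 5) (Fin 5) ℤ :=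
  !![(0 : ℤ), 0, 0, 0, 1; 1, 0, 0, 0, 0; 0, 1, 0, 0, 1; 0, 0, 1, 0, -1; 0, 0, 0, 1, 0]

/-- The companion matrix `B` of `g(x) = x^5 + x^4 - x^3 - x^2 + x + 1`. -/
def matB : Matrix (Fin 5) (Fin 5) ℤ :=
  !![(0 : ℤ), 0, 0, 0, -1; 1, 0, 0, 0, -1; 0, 1, 0, 0, 1; 0, 0, 1, 0, 1; 0, 0, 0, 1, -1]

/-- The symmetric integer matrix `Q` of the quadratic form preserved by `Γ(f,g)`. -/
def matQ : Matrix (Fin 5) (Fin 5) ℤ :=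
  !![(1 : ℤ), -3, -1, 3, -5; -3, 1, -3, -1, 3; -1, -3, 1, -3, -1; 3, -1, -3, 1, -3; -5, 3, -1, -3, 1]

/-- The integral orthogonal group `O_Q(ℤ)` of a matrix `Q`, as the subgroup of `GL₅(ℤ)`
consisting of all `M` with `Mᵀ * Q * M = Q`. -/
def orthogonalSubgroup (Q : Matrix (Fin 5) (Fin 5) ℤ) : Subgroup (GL (Fin 5) ℤ) where
  carrier := { M : GL (Fin 5) ℤ |
      (M : Matrix (Fin 5) (Fin 5) ℤ)ᵀ * Q * (M : Matrix (Fin 5) (Fin 5) ℤ) = Q }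
  one_mem' := by simp
  mul_mem' := by
    intro a b ha hb
    simp only [Set.mem_setOf_eq, Units.val_mul, transpose_mul] at ha hb ⊢
    calc ((b : Matrix (Fin 5) (Fin 5) ℤ)ᵀ * (a : Matrix (Fin 5) (Fin 5) ℤ)ᵀ) * Q *
          ((a : Matrix (Fin 5) (Fin 5) ℤ) * (b : Matrix (Fin 5) (Fin 5) ℤ))
        = (b : Matrix (Fin 5) (Fin 5) ℤ)ᵀ *
            ((a : Matrix (Fin 5) (Fin 5) ℤ)ᵀ * Q * (a : Matrix (Fin 5) (Fin 5) ℤ)) *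
            (b : Matrix (Fin 5) (Fin 5) ℤ) := by
          simp only [mul_assoc]
      _ = Q := by rw [ha, hb]
  inv_mem' := by
    intro a ha
    simp only [Set.mem_setOf_eq] at ha ⊢
    calc ((a⁻¹ : GL (Fin 5) ℤ) : Matrix (Fin 5) (Fin 5) ℤ)ᵀ * Q *
          ((a⁻¹ : GL (Fin 5) ℤ) : Matrix (Fin 5) (Fin 5) ℤ)
        = ((a⁻¹ : GL (Fin 5) ℤ) : Matrix (Fin 5) (Fin 5) ℤ)ᵀ *
            ((a : Matrix (Fin 5) (Fin 5) ℤ)ᵀ * Q * (a : Matrix (Fin 5) (Fin 5) ℤ)) *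
            ((a⁻¹ : GL (Fin 5) ℤ) : Matrix (Fin 5) (Fin 5) ℤ) := by rw [ha]
      _ = ((a : Matrix (Fin 5) (Fin 5) ℤ) *
            ((a⁻¹ : GL (Fin 5) ℤ) : Matrix (Fin 5) (Fin 5) ℤ))ᵀ * Q *
          ((a : Matrix (Fin 5) (Fin 5) ℤ) *
            ((a⁻¹ : GL (Fin 5) ℤ) : Matrix (Fin 5) (Fin 5) ℤ)) := by
          simp only [transpose_mul, mul_assoc]
      _ = Q := by rw [Units.mul_inv]; simp

/-- Value of the inhomogeneous form at a translate. -/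
def nf (p q w : ℚ) (i j k : ℤ) : ℚ :=
  2/3 * ((p + (2*i-j))^2 + (p + (2*i-j)) * (q + (2*j-i)) + (q + (2*j-i))^2) - 12 * (w + k)^2

/-- `x` lies outside the open unit interval around zero. -/
def Far (x : ℚ) : Prop := 1 ≤ x ∨ x ≤ -1

lemma sector_core (m n w : ℚ) (hm : 0 ≤ m) (hn : 0 ≤ n) (hmn : m + n ≤ 1)
    (hw0 : 0 ≤ w) (hw : w ≤ 1/2) (N t : ℚ) (hN : N = 2/3 * (m^2+m*n+n^2)) (ht : t = 12 * w^2)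
    (k0 : Far (N - t))
    (k1 : Far (N + 2 + 2*m - t)) (k2 : Far (N + 2 + 2*n - t)) (k3 : Far (N + 2 + 2*(m+n) - t))
    (k4 : Far (N + 2 - 2*m - t)) (k5 : Far (N + 2 - 2*n - t)) (k6 : Far (N + 2 - 2*(m+n) - t))
    (l1 : Far (N + 2 + 2*m - t + 24 * w - 12)) (l2 : Far (N + 2 + 2*n - t + 24 * w - 12))
    (l7 : m = 0 → n = 0 → Far (6 - t + 24 * w - 12)) :
    m = 0 ∧ n = 0 ∧ w = 1/2 := by
  have ht0 : 0 ≤ t := by rw [ht]; positivity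
  have ht3 : t ≤ 3 := by rw [ht]; nlinarith
  have hN0 : 0 ≤ N := by rw [hN]; positivity
  have hN1 : N < 1 := by
    rw [hN]; nlinarith [mul_nonneg hm hn]
  have k0' : N + 1 ≤ t := by
    rcases k0 with h | h <;> linarith
  unfold Far at *
  by_cases hz : m = 0 ∧ n = 0
  · obtain ⟨rfl, rfl⟩ := hz
    have : N = 0 := by rw [hN]; ring
    subst this
    refine ⟨rfl, rfl, ?_⟩
    rcases k1 with h | h
    · exfalso
      have h1 : t = 1 := by linarith
      have h2 : 1/4 < w := by nlinarith
      have h3 : w < 1/3 := by nlinarith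
      rcases l7 rfl rfl with h | h <;> linarith
    · have h1 : t = 3 := by linarith
      nlinarith
  exfalso
  have hs : 0 < m + n := by
    rcases hm.lt_or_eq with h | h
    · linarith
    · rcases hn.lt_or_eq with h' | h'
      · linarith
      · exact absurd ⟨h.symm, h'.symm⟩ hz
  have hNpos : 0 < N := by rw [hN]; nlinarith [mul_nonneg hm hn, mul_pos hs hs]
  have a6 : N + 2 - 2*(m+n) - t ≤ -1 := by
    rcases k6 with h | h
    · linarith
    · exact h
  have a3 : 1 ≤ N + 2 + 2*(m+n) - t := by
    rcases k3 with h | h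
    · exact h
    · linarith
  have deep : t = 5/3 → w < 3/8 ∧ 1/3 < w := by
    intro h
    refine ⟨?_, ?_⟩ <;> nlinarith
  have mid : t = 5/2 → w < 1/2 ∧ 10/24 < w := by
    intro h
    refine ⟨?_, ?_⟩ <;> nlinarith
  rcases k4 with h4 | h4
  · rcases k5 with h5 | h5
    · linarith
    · -- n = 1, m = 0
      have h1 : n = 1 := by linarith
      have h2 : m = 0 := by linarith
      subst h1 h2
      have h3 : N = 2/3 := by rw [hN]; ring
      obtain ⟨h6, h7⟩ := deep (by linarith)
      rcases l2 with h | h <;> linarith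
  · rcases k5 with h5 | h5
    · have h1 : m = 1 := by linarith
      have h2 : n = 0 := by linarith
      subst h1 h2
      have h3 : N = 2/3 := by rw [hN]; ring
      obtain ⟨h6, h7⟩ := deep (by linarith)
      rcases l1 with h | h <;> linarith
    · rcases k1 with h1 | h1
      · rcases k2 with h2 | h2
        · have hm' : m = 1/2 := by linarith
          have hn' : n = 1/2 := by linarith
          subst hm' hn'
          have h3 : N = 1/2 := by rw [hN]; ring
          obtain ⟨h6, h7⟩ := mid (by linarith)
          rcases l1 with h | h <;> linarith
        · linarith
      · rcases k2 with h2 | h2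
        · linarith
        · linarith

lemma cover_core (p q w : ℚ) (hp : |p| ≤ 1) (hq : |q| ≤ 1) (hpq : |p+q| ≤ 1)
    (hw0 : 0 ≤ w) (hw : w ≤ 1/2) :
    (∃ i j k : ℤ, |nf p q w i j k| < 1) ∨ (p = 0 ∧ q = 0 ∧ w = 1/2) := by
  by_contra hcon
  push Not at hcon
  obtain ⟨hall, hex⟩ := hcon
  rw [abs_le] at hp hq hpq
  have key : ∀ (i j k : ℤ) (x : ℚ), nf p q w i j k = x → Far x := by
    rintro i j k x rfl
    have := hall i j k
    rwa [le_abs, le_neg] at this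
  have fin : ∀ m n : ℚ, (m = 0 ∧ n = 0 ∧ w = 1/2) → (m = 0 → n = 0 → p = 0 ∧ q = 0) → False := by
    rintro m n ⟨h1, h2, h3⟩ h
    exact hex (h h1 h2).1 (h h1 h2).2 h3
  obtain ⟨N, hN⟩ : ∃ n, n = 2/3 * (p^2+p*q+q^2) := ⟨_, rfl⟩
  obtain ⟨t, ht⟩ : ∃ t, t = 12 * w^2 := ⟨_, rfl⟩
  have k0 : Far (N - t) := key 0 0 0 _ (by rw [hN, ht, nf]; push_cast; ring)
  have k1 : Far (N + 2 + 2*p - t) := key 1 0 0 _ (by rw [hN, ht, nf]; push_cast; ring)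
  have k2 : Far (N + 2 + 2*q - t) := key 0 1 0 _ (by rw [hN, ht, nf]; push_cast; ring)
  have k3 : Far (N + 2 + 2*(p+q) - t) := key 1 1 0 _ (by rw [hN, ht, nf]; push_cast; ring)
  have k4 : Far (N + 2 - 2*p - t) := key (-1) 0 0 _ (by rw [hN, ht, nf]; push_cast; ring)
  have k5 : Far (N + 2 - 2*q - t) := key 0 (-1) 0 _ (by rw [hN, ht, nf]; push_cast; ring)
  have k6 : Far (N + 2 - 2*(p+q) - t) := key (-1) (-1) 0 _ (by rw [hN, ht, nf]; push_cast; ring)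
  have l1 : Far (N + 2 + 2*p - t + 24 * w - 12) :=
    key 1 0 (-1) _ (by rw [hN, ht, nf]; push_cast; ring)
  have l2 : Far (N + 2 + 2*q - t + 24 * w - 12) :=
    key 0 1 (-1) _ (by rw [hN, ht, nf]; push_cast; ring)
  have l3 : Far (N + 2 + 2*(p+q) - t + 24 * w - 12) :=
    key 1 1 (-1) _ (by rw [hN, ht, nf]; push_cast; ring)
  have l4 : Far (N + 2 - 2*p - t + 24 * w - 12) :=
    key (-1) 0 (-1) _ (by rw [hN, ht, nf]; push_cast; ring)
  have l5 : Far (N + 2 - 2*q - t + 24 * w - 12) :=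
    key 0 (-1) (-1) _ (by rw [hN, ht, nf]; push_cast; ring)
  have l6 : Far (N + 2 - 2*(p+q) - t + 24 * w - 12) :=
    key (-1) (-1) (-1) _ (by rw [hN, ht, nf]; push_cast; ring)
  have l7 : p = 0 → q = 0 → Far (6 - t + 24 * w - 12) := by
    rintro rfl rfl
    exact key 1 (-1) (-1) _ (by rw [ht, nf]; push_cast; ring)
  rcases le_total 0 p with h1 | h1 <;> rcases le_total 0 q with h2 | h2
  · exact fin p q (sector_core p q w h1 h2 hpq.2 hw0 hw N t hN ht k0 k1 k2 k3 k4 k5 k6 l1 l2 l7)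
      (fun a b => ⟨a, b⟩)
  · rcases le_total 0 (p+q) with h3 | h3
    · refine fin (p+q) (-q) (sector_core (p+q) (-q) w h3 (by linarith) (by linarith) hw0 hw N t
        (by rw [hN]; ring) ht k0 k3 (by convert k5 using 1; ring) (by convert k1 using 1; ring) k6
        (by convert k2 using 1; ring) (by convert k4 using 1; ring) l3
        (by convert l5 using 1; ring) (fun a b => l7 (by linarith) (by linarith)))
        (fun a b => ⟨by linarith, by linarith⟩)
    · refine fin p (-(p+q)) (sector_core p (-(p+q)) w h1 (by linarith) (by linarith) hw0 hw N t
        (by rw [hN]; ring) ht k0 k1 (by convert k6 using 1; ring) (by convert k5 using 1; ring) k4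
        (by convert k3 using 1; ring) (by convert k2 using 1; ring) l1
        (by convert l6 using 1; ring) (fun a b => l7 (by linarith) (by linarith)))
        (fun a b => ⟨by linarith, by linarith⟩)
  · rcases le_total 0 (p+q) with h3 | h3
    · refine fin (-p) (p+q) (sector_core (-p) (p+q) w (by linarith) h3 (by linarith) hw0 hw N t
        (by rw [hN]; ring) ht k0 (by convert k4 using 1; ring) k3 (by convert k2 using 1; ring)
        (by convert k1 using 1; ring) k6 (by convert k5 using 1; ring)
        (by convert l4 using 1; ring) l3 (fun a b => l7 (by linarith) (by linarith)))
        (fun a b => ⟨by linarith, by linarith⟩)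
    · refine fin (-(p+q)) q (sector_core (-(p+q)) q w (by linarith) h2 (by linarith) hw0 hw N t
        (by rw [hN]; ring) ht k0 (by convert k6 using 1; ring) k2 (by convert k4 using 1; ring)
        (by convert k3 using 1; ring) k5 (by convert k1 using 1; ring)
        (by convert l6 using 1; ring) l2 (fun a b => l7 (by linarith) (by linarith)))
        (fun a b => ⟨by linarith, by linarith⟩)
  · refine fin (-p) (-q) (sector_core (-p) (-q) w (by linarith) (by linarith) (by linarith) hw0 hw
        N t (by rw [hN]; ring) ht k0 (by convert k4 using 1; ring) (by convert k5 using 1; ring)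
        (by convert k6 using 1; ring)
        (by convert k1 using 1; ring) (by convert k2 using 1; ring) (by convert k3 using 1; ring)
        (by convert l4 using 1; ring) (by convert l5 using 1; ring)
        (fun a b => l7 (by linarith) (by linarith)))
        (fun a b => ⟨by linarith, by linarith⟩)

/-- Every point of the plane is congruent modulo the root lattice to a point of the Voronoi cell. -/
lemma voronoi (p q : ℚ) : ∃ i j : ℤ, |p + (2*i-j)| ≤ 1 ∧ |q + (2*j-i)| ≤ 1 ∧
    |p + (2*i-j) + (q + (2*j-i))| ≤ 1 := by
  obtain ⟨x, hx⟩ : ∃ x, x = (2*p+q)/3 := ⟨_, rfl⟩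
  obtain ⟨y, hy⟩ : ∃ x, x = (p+2*q)/3 := ⟨_, rfl⟩
  have hp : p = 2*x-y := by linarith
  have hq : q = 2*y-x := by linarith
  have x0 := Int.floor_le x
  have x1 := Int.lt_floor_add_one x
  have y0 := Int.floor_le y
  have y1 := Int.lt_floor_add_one y
  generalize ⌊x⌋ = a at *
  generalize ⌊y⌋ = b at *
  simp only [abs_le, hp, hq]
  by_contra hcon
  push Not at hcon
  have h00 := hcon (-a) (-b)
  have h10 := hcon (-a-1) (-b)
  have h01 := hcon (-a) (-b-1)
  have h11 := hcon (-a-1) (-b-1)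
  push_cast at h00 h10 h01 h11
  clear hcon hp hq hx hy
  obtain ⟨u, hu⟩ : ∃ u, u = x - a := ⟨_, rfl⟩
  obtain ⟨v, hv⟩ : ∃ u, u = y - b := ⟨_, rfl⟩
  have ex : x = u + a := by linarith
  have ey : y = v + b := by linarith
  subst ex ey
  by_cases c1 : u + v ≤ 1
  · by_cases c2 : 2*u-v ≤ 1
    · by_cases c3 : 2*v-u ≤ 1
      · exact absurd (h00 ⟨by linarith, by linarith⟩ ⟨by linarith, by linarith⟩ (by linarith))
          (by linarith)
      · exact absurd (h01 ⟨by linarith, by linarith⟩ ⟨by linarith, by linarith⟩ (by linarith))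
          (by linarith)
    · exact absurd (h10 ⟨by linarith, by linarith⟩ ⟨by linarith, by linarith⟩ (by linarith))
          (by linarith)
  · by_cases c2 : 2*u-v < 0
    · exact absurd (h01 ⟨by linarith, by linarith⟩ ⟨by linarith, by linarith⟩ (by linarith))
          (by linarith)
    · by_cases c3 : 2*v-u < 0
      · exact absurd (h10 ⟨by linarith, by linarith⟩ ⟨by linarith, by linarith⟩ (by linarith))
          (by linarith)
      · exact absurd (h11 ⟨by linarith, by linarith⟩ ⟨by linarith, by linarith⟩ (by linarith))
          (by linarith)

lemma cover (p q w : ℚ) : ∃ i j k : ℤ, |nf p q w i j k| < 1 ∨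
    (p + (2*i-j) = 0 ∧ q + (2*j-i) = 0 ∧ w + k = 1/2) := by
  obtain ⟨i, j, h1, h2, h3⟩ := voronoi p q
  have hr := abs_sub_round w
  rcases le_total 0 (w - round w) with hs | hs
  · rw [abs_of_nonneg hs] at hr
    rcases cover_core _ _ (w - round w) h1 h2 h3 hs hr with ⟨i', j', k', h⟩ | ⟨h4, h5, h6⟩
    · refine ⟨i+i', j+j', -round w + k', Or.inl ?_⟩
      convert h using 2
      unfold nf; push_cast; ring
    · exact ⟨i, j, -round w, Or.inr ⟨h4, h5, by push_cast; linarith⟩⟩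
  · rw [abs_of_nonpos hs] at hr
    rcases cover_core _ _ (-(w - round w)) h1 h2 h3 (by linarith) hr with
      ⟨i', j', k', h⟩ | ⟨h4, h5, h6⟩
    · refine ⟨i+i', j+j', -round w - k', Or.inl ?_⟩
      convert h using 2
      unfold nf; push_cast; ring
    · exact ⟨i, j, -round w + 1, Or.inr ⟨h4, h5, by push_cast; linarith⟩⟩

lemma cover_int (b c d z : ℤ) (hb : b ≠ 0) : ∃ i j k : ℤ,
    |8 * ((c + b*(2*i-j))^2 + (c + b*(2*i-j)) * (d + b*(2*j-i)) + (d + b*(2*j-i))^2)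
      - (z - 12*b*k)^2| < 12 * b^2 ∨
    (c + b*(2*i-j) = 0 ∧ d + b*(2*j-i) = 0 ∧ z - 12*b*k = -6*b) := by
  have hb' : (b:ℚ) ≠ 0 := by exact_mod_cast hb
  obtain ⟨i, j, k, h⟩ := cover ((c:ℚ)/b) (d/b) (-z/(12*b))
  refine ⟨i, j, k, ?_⟩
  rcases h with h | ⟨h1, h2, h3⟩
  · left
    have h12 : (0:ℚ) < 12 * b^2 := by positivity
    have : ((|8 * ((c + b*(2*i-j))^2 + (c + b*(2*i-j)) * (d + b*(2*j-i)) + (d + b*(2*j-i))^2)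
      - (z - 12*b*k)^2| : ℤ) : ℚ) = |nf ((c:ℚ)/b) (d/b) (-z/(12*b)) i j k| * (12 * b^2) := by
      rw [← abs_of_pos h12, ← abs_mul]
      push_cast
      congr 1
      unfold nf
      field_simp
      ring
    have h' := mul_lt_mul_of_pos_right h h12
    rw [← this, one_mul] at h'
    exact_mod_cast h'
  · right
    refine ⟨?_, ?_, ?_⟩
    · have : (c:ℚ) + b*(2*i-j) = 0 := by
        field_simp at h1; linarith
      exact_mod_cast this
    · have : (d:ℚ) + b*(2*j-i) = 0 := by
        field_simp at h2; linarith
      exact_mod_cast this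
    · have : (z:ℚ) - 12*b*k = -6*b := by
        field_simp at h3; linarith
      exact_mod_cast this

/-- Unimodular change of coordinates. -/
def matT : Matrix (Fin 5) (Fin 5) ℤ :=
  !![-1, 0, 0, -1, 0; 0, -1, 0, 0, -1; 0, 0, 0, -1, 0; 0, -1, 0, 0, 0; 1, 3, -1, 3, 1]

/-- Inverse of `matT`. -/
def matTi : Matrix (Fin 5) (Fin 5) ℤ :=
  !![-1, 0, 1, 0, 0; 0, 0, 0, -1, 0; -1, -1, -2, -2, -1; 0, 0, -1, 0, 0; 0, -1, 0, 1, 0]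

/-- The form `Q` in the new coordinates. -/
def matF : Matrix (Fin 5) (Fin 5) ℤ :=
  !![0, -6, 0, 0, 0; -6, 0, 0, 0, 0; 0, 0, -8, -4, 0; 0, 0, -4, -8, 0; 0, 0, 0, 0, 1]

/-- `A` in the new coordinates. -/
def tA : Matrix (Fin 5) (Fin 5) ℤ :=
  !![1, 1, 2, 2, 1; 1, 0, 0, 0, 0; 1, 0, 2, 3, 1; 1, 0, -1, 0, 0; -6, 0, -4, -8, -3]

/-- `B` in the new coordinates. -/
def tB : Matrix (Fin 5) (Fin 5) ℤ :=
  !![1, 1, 2, 2, 1; 1, -2, 0, 2, 0; 1, 2, 2, 1, 1; 1, -1, -1, 1, 0; -6, 0, -4, -8, -3]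

/-- inverse of `tA` -/
def tA' : Matrix (Fin 5) (Fin 5) ℤ := !![0, 1, 0, 0, 0; 1, 1, 2, 2, 1; 0, 1, 0, -1, 0; 0, 1, 3, 2, 1; 0, -6, -8, -4, -3]

/-- inverse of `tB` -/
def tB' : Matrix (Fin 5) (Fin 5) ℤ := !![-2, 1, 2, 0, 0; 1, 1, 2, 2, 1; -1, 1, 1, -1, 0; 2, 1, 1, 2, 1; 0, -6, -8, -4, -3]

/-- The unipotent elements fixing the cusp. -/
def matU (i j k : ℤ) : Matrix (Fin 5) (Fin 5) ℤ :=
  !![1, -(2*(i^2-i*j+j^2)-12*k^2), -2*i, -2*j, -2*k;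
     0, 1, 0, 0, 0;
     0, 2*i-j, 1, 0, 0;
     0, 2*j-i, 0, 1, 0;
     0, -12*k, 0, 0, 1]

/-- Reflections in the roots `i a₁ + j a₂ + d`. -/
def matR (i j : ℤ) : Matrix (Fin 5) (Fin 5) ℤ :=
  !![1, 0, 0, 0, 0;
     0, 1, 0, 0, 0;
     0, 0, 1 - (2*i-j)*i, -((2*i-j)*j), -(2*i-j);
     0, 0, -((2*j-i)*i), 1-(2*j-i)*j, -(2*j-i);
     0, 0, 12*i, 12*j, 13]

/-- The first simple reflection. -/
def matW1 : Matrix (Fin 5) (Fin 5) ℤ :=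
  !![1, 0, 0, 0, 0; 0, 1, 0, 0, 0; 0, 0, -1, 0, 0; 0, 0, 1, 1, 0; 0, 0, 0, 0, 1]

/-- The second simple reflection. -/
def matW2 : Matrix (Fin 5) (Fin 5) ℤ :=
  !![1, 0, 0, 0, 0; 0, 1, 0, 0, 0; 0, 0, 1, 1, 0; 0, 0, 0, -1, 0; 0, 0, 0, 0, 1]

/-- Preservation of the form. -/
def Pres (X : Matrix (Fin 5) (Fin 5) ℤ) : Prop := Xᵀ * matF * X = matF

/-- `M` represents an element of `H` in the new coordinates. -/
def InG (H : Subgroup (GL (Fin 5) ℤ)) (M : Matrix (Fin 5) (Fin 5) ℤ) : Prop :=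
  Pres M ∧ ∃ γ ∈ H, matT * (γ : Matrix (Fin 5) (Fin 5) ℤ) = M * matT

lemma Pres.mul {X Y : Matrix (Fin 5) (Fin 5) ℤ} (hX : Pres X) (hY : Pres Y) : Pres (X * Y) := by
  unfold Pres at *
  calc (X * Y)ᵀ * matF * (X * Y) = Yᵀ * (Xᵀ * matF * X) * Y := by
        simp only [transpose_mul, mul_assoc]
    _ = matF := by rw [hX, hY]

lemma T_Ti : matT * matTi = 1 := by decide +kernel
lemma Ti_T : matTi * matT = 1 := by decide +kernel

lemma twelve (P : ℤ → ℤ → Prop) (h1 : P 3 2) (h2 : P (-1) 2) (h3 : P 3 1) (h4 : P (-2) 1)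
    (h5 : P (-1) (-3)) (h6 : P (-2) (-3)) (g1 : P 2 3) (g2 : P 1 3) (g3 : P 2 (-1))
    (g4 : P (-3) (-1)) (g5 : P 1 (-2)) (g6 : P (-3) (-2)) (i j : ℤ)
    (hij : i^2 - i*j + j^2 = 7) : P i j := by
  have h1 : -3 ≤ i := by nlinarith [sq_nonneg (2*j-i)]
  have h2 : i ≤ 3 := by nlinarith [sq_nonneg (2*j-i)]
  have h3 : -3 ≤ j := by nlinarith [sq_nonneg (2*i-j)]
  have h4 : j ≤ 3 := by nlinarith [sq_nonneg (2*i-j)]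
  interval_cases i <;> interval_cases j <;> first | assumption | (exfalso; revert hij; decide)

section grp
variable {H : Subgroup (GL (Fin 5) ℤ)} {M N : Matrix (Fin 5) (Fin 5) ℤ}

lemma InG.one : InG H 1 := ⟨by simp [Pres], 1, H.one_mem, by simp⟩

lemma InG.mul (hM : InG H M) (hN : InG H N) : InG H (M * N) := by
  obtain ⟨p, g, hg, e⟩ := hM
  obtain ⟨p', g', hg', e'⟩ := hN
  refine ⟨p.mul p', g * g', H.mul_mem hg hg', ?_⟩
  rw [Units.val_mul, ← mul_assoc, e, mul_assoc, e', mul_assoc]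

lemma InG.inv (hM : InG H M) (h : N * M = 1) : InG H N := by
  have h' : M * N = 1 := mul_eq_one_comm.mp h
  obtain ⟨p, g, hg, e⟩ := hM
  refine ⟨?_, g⁻¹, H.inv_mem hg, ?_⟩
  · unfold Pres at *
    calc Nᵀ * matF * N = Nᵀ * (Mᵀ * matF * M) * N := by rw [p]
      _ = (M * N)ᵀ * matF * (M * N) := by simp only [transpose_mul, mul_assoc]
      _ = matF := by rw [h']; simp
  · have h1 : matT = N * matT * (g : Matrix (Fin 5) (Fin 5) ℤ) := by
      rw [mul_assoc, e, ← mul_assoc, h, one_mul]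
    calc matT * ((g⁻¹ : GL (Fin 5) ℤ) : Matrix (Fin 5) (Fin 5) ℤ)
        = N * matT * ((g : Matrix (Fin 5) (Fin 5) ℤ) *
          ((g⁻¹ : GL (Fin 5) ℤ) : Matrix (Fin 5) (Fin 5) ℤ)) := by
            rw [← mul_assoc, ← h1]
      _ = N * matT := by rw [Units.mul_inv, mul_one]

lemma InG.of_eq (hM : InG H M) (h : M = N) : InG H N := h ▸ hM

lemma U_add (i j k i' j' k' : ℤ) : matU i j k * matU i' j' k' = matU (i+i') (j+j') (k+k') := by
  ext a b
  fin_cases a <;> fin_cases b <;> simp [matU, Matrix.mul_apply, Fin.sum_univ_five] <;> ring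

lemma U_zero : matU 0 0 0 = 1 := by decide +kernel

lemma U_zmul (i j k : ℤ) (h : InG H (matU i j k)) (n : ℤ) :
    InG H (matU (n*i) (n*j) (n*k)) := by
  have hneg : InG H (matU (-i) (-j) (-k)) := h.inv (by rw [U_add]; simp [U_zero])
  induction n with
  | zero => simpa [U_zero] using InG.one
  | succ n ih =>
    refine (ih.mul h).of_eq ?_
    rw [U_add]; congr 1 <;> ring
  | pred n ih =>
    refine (ih.mul hneg).of_eq ?_
    rw [U_add]; congr 1 <;> ring

lemma U_all (h1 : InG H (matU 1 0 0)) (h2 : InG H (matU 0 1 0)) (h3 : InG H (matU 3 2 1))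
    (i j k : ℤ) : InG H (matU i j k) := by
  have a := ((U_zmul _ _ _ h1 (i - 3*k)).mul (U_zmul _ _ _ h2 (j-2*k))).mul (U_zmul _ _ _ h3 k)
  rw [U_add, U_add] at a
  refine a.of_eq ?_
  congr 1 <;> ring

lemma R_W1 (i j : ℤ) (h : InG H (matR i j)) (hw : InG H matW1) : InG H (matR (j-i) j) := by
  refine ((hw.mul h).mul hw).of_eq ?_
  ext a b
  fin_cases a <;> fin_cases b <;>
    simp [matW1, matR, Matrix.mul_apply, Fin.sum_univ_five] <;> ring

lemma R_W2 (i j : ℤ) (h : InG H (matR i j)) (hw : InG H matW2) : InG H (matR i (i-j)) := by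
  refine ((hw.mul h).mul hw).of_eq ?_
  ext a b
  fin_cases a <;> fin_cases b <;>
    simp [matW2, matR, Matrix.mul_apply, Fin.sum_univ_five] <;> ring

/-- All the elements of the group that the reduction uses. -/
structure Good (H : Subgroup (GL (Fin 5) ℤ)) : Prop where
  sig : InG H tA
  rho : InG H (tB * tB)
  U : ∀ i j k, InG H (matU i j k)
  R : ∀ i j : ℤ, i^2 - i*j + j^2 = 7 → InG H (matR i j)

lemma good (hA : InG H tA) (hB : InG H tB) : Good H := by
  have ha : InG H tA' := hA.inv (by decide +kernel)
  have hb : InG H tB' := hB.inv (by decide +kernel)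
  have W1 : InG H matW1 := (((ha.mul ha).mul hB).mul hA).of_eq (by decide +kernel)
  have W2 : InG H matW2 := (((hA.mul hB).mul ha).mul ha).of_eq (by decide +kernel)
  have U1 : InG H (matU 1 0 0) :=
    (W1.mul ((((((((ha.mul hb).mul ha).mul ha).mul hB).mul hA).mul hB).mul hA))).of_eq (by decide +kernel)
  have U2 : InG H (matU 0 1 0) :=
    (W2.mul ((((((((((hA.mul hB).mul ha).mul ha).mul ha).mul hB).mul hA).mul hA).mul hb).mul ha))).of_eq (by decide +kernel)
  have R32 : InG H (matR 3 2) :=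
    ((((((((((hb.mul hA).mul hA).mul hB).mul hB).mul ha).mul hb).mul ha).mul ha).mul hB)).of_eq (by decide +kernel)
  have R23 : InG H (matR 2 3) :=
    ((((((((((hB.mul ha).mul ha).mul hb).mul ha).mul hB).mul hB).mul hA).mul hA).mul hb)).of_eq (by decide +kernel)
  have U3 : InG H (matU 3 2 1) :=
    (R32.mul ((((((hA.mul hA).mul hB).mul ha).mul ha).mul ha))).of_eq (by decide +kernel)
  refine ⟨hA, hB.mul hB, U_all U1 U2 U3, ?_⟩
  have a1 := R_W1 _ _ R32 W1
  have a2 := R_W2 _ _ R32 W2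
  have a3 := R_W1 _ _ a2 W1
  have a4 := R_W2 _ _ a1 W2
  have a5 := R_W1 _ _ a4 W1
  have b1 := R_W1 _ _ R23 W1
  have b2 := R_W2 _ _ R23 W2
  have b3 := R_W1 _ _ b2 W1
  have b4 := R_W2 _ _ b1 W2
  have b5 := R_W1 _ _ b4 W1
  norm_num at a1 a2 a3 a4 a5 b1 b2 b3 b4 b5
  exact twelve (fun i j => InG H (matR i j)) R32 a1 a2 a3 a4 a5 R23 b1 b2 b3 b4 b5

end grp

lemma bil {X : Matrix (Fin 5) (Fin 5) ℤ} (h : Pres X) (i j : Fin 5) :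
    -6 * (X 0 i * X 1 j + X 1 i * X 0 j) - 8 * (X 2 i * X 2 j) - 4 * (X 2 i * X 3 j + X 3 i * X 2 j)
      - 8 * (X 3 i * X 3 j) + X 4 i * X 4 j = matF i j := by
  have := congrFun (congrFun h i) j
  rw [← this]
  simp [matF, Matrix.mul_apply, Fin.sum_univ_five]
  ring

/-- Isotropic vectors. -/
def Iso (v : Fin 5 → ℤ) : Prop :=
  12 * v 0 * v 1 + 8 * (v 2 ^ 2 + v 2 * v 3 + v 3 ^ 2) = v 4 ^ 2

lemma U_vec (i j k : ℤ) (v : Fin 5 → ℤ) : matU i j k *ᵥ v =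
    ![v 0 - (2*(i^2-i*j+j^2)-12*k^2) * v 1 - 2*i*v 2 - 2*j*v 3 - 2*k*v 4, v 1,
      v 2 + v 1 * (2*i-j), v 3 + v 1 * (2*j-i), v 4 - 12 * v 1 * k] := by
  ext a
  fin_cases a <;> simp [matU, Matrix.mulVec, dotProduct, Fin.sum_univ_five] <;> ring

lemma A_vec (v : Fin 5 → ℤ) : tA *ᵥ v =
    ![v 0 + v 1 + 2 * v 2 + 2 * v 3 + v 4, v 0, v 0 + 2 * v 2 + 3 * v 3 + v 4, v 0 - v 2,
      -6 * v 0 - 4 * v 2 - 8 * v 3 - 3 * v 4] := by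
  ext a
  fin_cases a <;> simp [tA, Matrix.mulVec, dotProduct, Fin.sum_univ_five] <;> ring

lemma BB_vec (v : Fin 5 → ℤ) : ((tB * tB) *ᵥ v) 1 = v 0 + 3 * v 1 + v 4 := by
  have : tB * tB = !![0, 1, 0, 0, 0; 1, 3, 0, 0, 1; 0, 0, 1, 1, 0; 0, 0, -1, 0, 0; 0, -6, 0, 0, -1] := by
    decide +kernel
  rw [this]
  simp [Matrix.mulVec, dotProduct, Fin.sum_univ_five]

lemma R_vec (i j : ℤ) (v : Fin 5 → ℤ) : matR i j *ᵥ v =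
    ![v 0, v 1, v 2 - (2*i-j) * (i * v 2 + j * v 3 + v 4),
      v 3 - (2*j-i) * (i * v 2 + j * v 3 + v 4), v 4 + 12 * (i * v 2 + j * v 3 + v 4)] := by
  ext a
  fin_cases a <;> simp [matR, Matrix.mulVec, dotProduct, Fin.sum_univ_five] <;> ring

lemma step1 {H : Subgroup (GL (Fin 5) ℤ)} (hH : Good H) : ∀ (n : ℕ) (v : Fin 5 → ℤ),
    (v 1).natAbs = n → Iso v → ∃ M, InG H M ∧ (M *ᵥ v) 1 = 0 := by
  intro n
  induction n using Nat.strong_induction_on with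
  | _ n ih =>
  intro v hn hv
  by_cases hb : v 1 = 0
  · exact ⟨1, InG.one, by simpa using hb⟩
  obtain ⟨i, j, k, h⟩ := cover_int (v 1) (v 2) (v 3) (v 4) hb
  have hUv := U_vec i j k v
  set u := matU i j k *ᵥ v with hu
  have hu1 : u 1 = v 1 := by rw [hUv]; simp
  have hu2 : v 2 + v 1 * (2*i-j) = u 2 := by rw [hUv]; simp
  have hu3 : v 3 + v 1 * (2*j-i) = u 3 := by rw [hUv]; simp
  have hu4 : v 4 - 12 * v 1 * k = u 4 := by rw [hUv]; simp
  have hiso : Iso u := by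
    unfold Iso at *
    rw [hUv]
    simp
    linear_combination hv
  rw [hu2, hu3, hu4] at h
  clear_value u
  unfold Iso at hiso
  rcases h with h | ⟨h2, h3, h4⟩
  · have e : 8 * (u 2 ^ 2 + u 2 * u 3 + u 3 ^ 2) - u 4 ^ 2 = -(12 * u 0 * u 1) := by
      linear_combination hiso
    rw [e, abs_neg, abs_mul, abs_mul, ← hu1, ← sq_abs (u 1)] at h
    have hb' : 0 < |u 1| := by rw [hu1]; exact abs_pos.mpr hb
    have hlt : |u 0| < |u 1| := by
      rw [abs_of_pos (by norm_num : (0:ℤ) < 12)] at h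
      by_contra hc
      push Not at hc
      nlinarith [mul_le_mul_of_nonneg_right hc hb'.le]
    have hA := A_vec u
    obtain ⟨M, hM, h0⟩ := ih (u 0).natAbs (by rw [← hn, ← hu1]; zify; exact hlt) (tA *ᵥ u)
      (by rw [hA]; simp) (by
        unfold Iso
        rw [hA]
        simp
        linear_combination hiso)
    refine ⟨M * (tA * matU i j k), hM.mul (hH.sig.mul (hH.U i j k)), ?_⟩
    rw [← Matrix.mulVec_mulVec, ← Matrix.mulVec_mulVec, ← hu, h0]
  · refine ⟨tB * tB * matU i j k, hH.rho.mul (hH.U i j k), ?_⟩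
    rw [← Matrix.mulVec_mulVec, ← hu, BB_vec, h4, hu1]
    rw [h2, h3, h4, hu1] at hiso
    have : 12 * v 1 * (u 0 - 3 * v 1) = 0 := by linear_combination hiso
    have h5 : u 0 - 3 * v 1 = 0 := by
      rcases mul_eq_zero.mp this with h | h
      · omega
      · exact h
    linarith

lemma aniso : ∀ (n : ℕ) (c d z : ℤ), z.natAbs = n → 8 * (c^2+c*d+d^2) = z^2 → c = 0 ∧ d = 0 ∧ z = 0 := by
  intro n
  induction n using Nat.strong_induction_on with
  | _ n ih =>
  intro c d z hn h
  by_cases hz : z = 0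
  · subst hz
    have h1 : c = 0 := by nlinarith [sq_nonneg (c + 2 * d), sq_nonneg c]
    have h2 : d = 0 := by nlinarith [sq_nonneg (2 * c + d), sq_nonneg d]
    exact ⟨h1, h2, rfl⟩
  exfalso
  have e2 : Even z := by
    have : Even (z^2) := ⟨4 * (c^2+c*d+d^2), by linarith⟩
    exact (Int.even_pow.mp this).1
  obtain ⟨y, rfl⟩ := e2
  have h1 : 2 * (c^2+c*d+d^2) = y^2 := by linarith [h, (by ring : (y+y)^2 = 4 * y^2)]
  have e3 : Even y := by
    have : Even (y^2) := ⟨(c^2+c*d+d^2), by linarith⟩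
    exact (Int.even_pow.mp this).1
  obtain ⟨x, rfl⟩ := e3
  have h2 : c^2+c*d+d^2 = 2 * x^2 := by linarith [h1, (by ring : (x+x)^2 = 4 * x^2)]
  have hev : Even c ∧ Even d := by
    have : Even (c^2+c*d+d^2) := ⟨x^2, by linarith⟩
    by_contra hcon
    rw [Int.even_add, Int.even_add, Int.even_mul, Int.even_pow, Int.even_pow] at this
    tauto
  obtain ⟨⟨c', rfl⟩, ⟨d', rfl⟩⟩ := hev
  have := ih (2 * x).natAbs (by omega) c' d' (2 * x) rfl (by linear_combination 2 * h2)
  omega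

/-- Bound in one sector. -/
lemma sector (p q z : ℤ) (hq : 0 ≤ q) (hpq : q ≤ p) (hz : 6 ≤ z)
    (h : 8 * (p^2+p*q+q^2) = z^2 - 1) : z < 3*p+2*q ∧ 6 * (3*p+2*q) < 7 * z := by
  constructor
  · by_contra hc
    push Not at hc
    have h1 : 25 * (8 * (p^2+p*q+q^2)) ≤ 24 * (3*p+2*q)^2 := by nlinarith
    have h2 : (3*p+2*q)^2 ≤ z^2 := by
      apply pow_le_pow_left₀ (by linarith) hc
    nlinarith
  · by_contra hc
    push Not at hc
    have h2 : (7*z)^2 ≤ (6*(3*p+2*q))^2 := by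
      apply pow_le_pow_left₀ (by linarith) hc
    nlinarith [sq_nonneg q, sq_nonneg p, sq_nonneg (p-4*q)]

lemma sector' (c d z : ℤ) (hz : 6 ≤ z) (h : 8 * (c^2+c*d+d^2) = z^2 - 1) :
    ∃ i j : ℤ, i^2 - i*j + j^2 = 7 ∧ z < i*c+j*d ∧ 6 * (i*c+j*d) < 7 * z := by
  have key : ∀ (i j p q : ℤ), i^2 - i*j + j^2 = 7 → 0 ≤ q → q ≤ p → i*c+j*d = 3*p+2*q →
      p^2+p*q+q^2 = c^2+c*d+d^2 →
      ∃ i j : ℤ, i^2 - i*j + j^2 = 7 ∧ z < i*c+j*d ∧ 6 * (i*c+j*d) < 7 * z := by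
    intro i j p q h1 h2 h3 h4 h5
    refine ⟨i, j, h1, ?_⟩
    rw [h4]
    exact sector p q z h2 h3 hz (by rw [h5, h])
  rcases le_total 0 c with h1 | h1 <;> rcases le_total 0 d with h2 | h2
  · rcases le_total c d with h3 | h3
    · exact key 2 3 d c (by norm_num) h1 h3 (by ring) (by ring)
    · exact key 3 2 c d (by norm_num) h2 h3 (by ring) (by ring)
  · rcases le_total 0 (c+d) with h3 | h3
    · rcases le_total (c+d) (-d) with h4 | h4
      · exact key 2 (-1) (-d) (c+d) (by norm_num) h3 h4 (by ring) (by ring)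
      · exact key 3 1 (c+d) (-d) (by norm_num) (by linarith) h4 (by ring) (by ring)
    · rcases le_total (-(c+d)) c with h4 | h4
      · exact key 1 (-2) c (-(c+d)) (by norm_num) (by linarith) h4 (by ring) (by ring)
      · exact key (-1) (-3) (-(c+d)) c (by norm_num) h1 h4 (by ring) (by ring)
  · rcases le_total 0 (c+d) with h3 | h3
    · rcases le_total (c+d) (-c) with h4 | h4
      · exact key (-1) 2 (-c) (c+d) (by norm_num) h3 h4 (by ring) (by ring)
      · exact key 1 3 (c+d) (-c) (by norm_num) (by linarith) h4 (by ring) (by ring)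
    · rcases le_total (-(c+d)) d with h4 | h4
      · exact key (-2) 1 d (-(c+d)) (by norm_num) (by linarith) h4 (by ring) (by ring)
      · exact key (-3) (-1) (-(c+d)) d (by norm_num) h2 h4 (by ring) (by ring)
  · rcases le_total (-c) (-d) with h3 | h3
    · exact key (-2) (-3) (-d) (-c) (by norm_num) (by linarith) h3 (by ring) (by ring)
    · exact key (-3) (-2) (-c) (-d) (by norm_num) (by linarith) h3 (by ring) (by ring)

lemma step2 {H : Subgroup (GL (Fin 5) ℤ)} (hH : Good H) : ∀ (n : ℕ) (v : Fin 5 → ℤ),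
    (v 4).natAbs = n → 8 * (v 2 ^ 2 + v 2 * v 3 + v 3 ^ 2) = v 4 ^ 2 - 1 →
    ∃ M, InG H M ∧ (∀ a b : ℤ, M *ᵥ ![a, b, 0, 0, 0] = ![a, b, 0, 0, 0]) ∧
      |(M *ᵥ v) 4| ≤ 5 := by
  intro n
  induction n using Nat.strong_induction_on with
  | _ n ih =>
  intro v hn hv
  by_cases hb : |v 4| ≤ 5
  · exact ⟨1, InG.one, by simp, by simpa using hb⟩
  push Not at hb
  have key : ∃ i j : ℤ, i^2 - i*j + j^2 = 7 ∧ |v 4 + 12 * (i * v 2 + j * v 3 + v 4)| < |v 4| := by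
    rcases le_total 0 (v 4) with h0 | h0
    · rw [abs_of_nonneg h0] at hb ⊢
      obtain ⟨i, j, h1, h2, h3⟩ := sector' (v 2) (v 3) (v 4) hb hv
      refine ⟨-i, -j, by linarith [h1, (by ring : (-i)^2 - (-i)*(-j) + (-j)^2 = i^2-i*j+j^2)], ?_⟩
      rw [abs_lt]
      constructor <;> linarith
    · rw [abs_of_nonpos h0] at hb ⊢
      obtain ⟨i, j, h1, h2, h3⟩ := sector' (v 2) (v 3) (-v 4) hb (by rw [hv]; ring)
      refine ⟨i, j, h1, ?_⟩
      rw [abs_lt]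
      constructor <;> linarith
  obtain ⟨i, j, h1, h2⟩ := key
  have hR := R_vec i j v
  obtain ⟨M, hM, h3, h4⟩ := ih (v 4 + 12 * (i * v 2 + j * v 3 + v 4)).natAbs
    (by rw [← hn]; zify; exact h2) (matR i j *ᵥ v)
    (by rw [hR]; rfl) (by
      rw [hR]
      simp
      linear_combination hv + 24 * (i * v 2 + j * v 3 + v 4)^2 * h1)
  refine ⟨M * matR i j, hM.mul (hH.R i j h1), ?_, ?_⟩
  · intro a b
    rw [← Matrix.mulVec_mulVec, R_vec]
    simpa using h3 a b
  · rwa [← Matrix.mulVec_mulVec]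

lemma mul_col_apply (M X : Matrix (Fin 5) (Fin 5) ℤ) (i j : Fin 5) : (M * X) i j = (M *ᵥ (fun a => X a j)) i :=
  rfl

lemma small (c d n m : ℤ) (hm : 0 ≤ m) (h : c^2+c*d+d^2 ≤ n) (hnm : 4 * n < 3 * (m+1)^2) :
    |c| ≤ m ∧ |d| ≤ m := by
  constructor
  · by_contra hc
    push Not at hc
    have : (m+1)^2 ≤ |c|^2 := pow_le_pow_left₀ (by linarith) hc 2
    rw [sq_abs] at this
    nlinarith [sq_nonneg (c+2*d)]
  · by_contra hc
    push Not at hc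
    have : (m+1)^2 ≤ |d|^2 := pow_le_pow_left₀ (by linarith) hc 2
    rw [sq_abs] at this
    nlinarith [sq_nonneg (2*c+d)]

lemma small_z (z n m : ℤ) (hm : 0 ≤ m) (h : z^2 ≤ n) (hnm : n < (m+1)^2) : |z| ≤ m := by
  by_contra hc
  push Not at hc
  have : (m+1)^2 ≤ |z|^2 := pow_le_pow_left₀ (by linarith) hc 2
  rw [sq_abs] at this
  linarith

/-- Columns orthogonal to a bounded time-like column are bounded. -/
lemma col_bound (c d z c' d' z' : ℤ) (h : 8 * (c^2+c*d+d^2) = z^2 + 8)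
    (h' : 8 * (c'^2+c'*d'+d'^2) = z'^2 - 1) (hz' : |z'| ≤ 5)
    (ho : 4 * (2 * (c * c') + c * d' + d * c' + 2 * (d * d')) = z * z') :
    |c| ≤ 13 ∧ |d| ≤ 13 ∧ |z| ≤ 13 := by
  have hz2 : z'^2 ≤ 25 := by
    rw [← sq_abs]; nlinarith [abs_nonneg z']
  have hcs : (z*z')^2 ≤ (8 * (c^2+c*d+d^2)) * (8 * (c'^2+c'*d'+d'^2)) := by
    rw [← ho]
    nlinarith [sq_nonneg (c*d'-c'*d)]
  rw [h, h'] at hcs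
  have hz : z^2 ≤ 192 := by nlinarith
  have := small c d 25 13 (by norm_num) (by linarith) (by norm_num)
  exact ⟨this.1, this.2, small_z z 192 13 (by norm_num) hz (by norm_num)⟩

lemma a_bound (a b c d z c' d' z' : ℤ) (hb : b = 1 ∨ b = -1)
    (hc : |c| ≤ 13) (hd : |d| ≤ 13) (hz : |z| ≤ 13) (hc' : |c'| ≤ 13) (hd' : |d'| ≤ 13)
    (hz' : |z'| ≤ 13)
    (h : -6 * (a * b) - 8 * (c * c') - 4 * (c * d' + d * c') - 8 * (d * d') + z * z' = 0) :
    |a| ≤ 5000 := by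
  have P : ∀ x y : ℤ, |x| ≤ 13 → |y| ≤ 13 → |x*y| ≤ 169 := by
    intro x y hx hy
    rw [abs_mul]
    calc |x| * |y| ≤ 13 * 13 := mul_le_mul hx hy (abs_nonneg _) (by norm_num)
      _ = 169 := by norm_num
  have p1 := abs_le.mp (P c c' hc hc')
  have p2 := abs_le.mp (P c d' hc hd')
  have p3 := abs_le.mp (P d c' hd hc')
  have p4 := abs_le.mp (P d d' hd hd')
  have p5 := abs_le.mp (P z z' hz hz')
  rw [abs_le]
  rcases hb with rfl | rfl <;> constructor <;> linarith

lemma a1_bound (a b c d z : ℤ) (hb : b = 1 ∨ b = -1)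
    (hc : |c| ≤ 1) (hd : |d| ≤ 1) (hz : |z| ≤ 12)
    (h : -12 * (a * b) - 8 * (c^2 + c * d + d^2) + z^2 = 0) : |a| ≤ 5000 := by
  have P : |c * d| ≤ 1 := by
    rw [abs_mul]
    calc |c| * |d| ≤ 1 * 1 := mul_le_mul hc hd (abs_nonneg _) (by norm_num)
      _ = 1 := by norm_num
  have p := abs_le.mp P
  have h1 : z^2 ≤ 12^2 := by rw [← sq_abs]; exact pow_le_pow_left₀ (abs_nonneg _) hz 2
  have h2 : c^2 ≤ 1^2 := by rw [← sq_abs]; exact pow_le_pow_left₀ (abs_nonneg _) hc 2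
  have h3 : d^2 ≤ 1^2 := by rw [← sq_abs]; exact pow_le_pow_left₀ (abs_nonneg _) hd 2
  have h6 := sq_nonneg z
  have h7 := sq_nonneg c
  have h8 := sq_nonneg d
  rw [abs_le]
  rcases hb with rfl | rfl <;> constructor <;> linarith

lemma final_bound (W : Matrix (Fin 5) (Fin 5) ℤ) (hW : Pres W) (u : ℤ) (hu : IsUnit u)
    (v0 : W 0 0 = u) (v1 : W 1 0 = 0) (v2 : W 2 0 = 0) (v3 : W 3 0 = 0) (v4 : W 4 0 = 0)
    (hb : W 1 1 = 1 ∨ W 1 1 = -1) (w12 : W 1 2 = 0) (w13 : W 1 3 = 0) (w14 : W 1 4 = 0)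
    (hi : |W 2 1| ≤ 1) (hj : |W 3 1| ≤ 1) (hk : |W 4 1| ≤ 12) (h2 : |W 4 4| ≤ 5) :
    ∀ l m, |W l m| ≤ 5000 := by
  have e11 := bil hW 1 1
  have e12 := bil hW 1 2
  have e13 := bil hW 1 3
  have e14 := bil hW 1 4
  have e22 := bil hW 2 2
  have e33 := bil hW 3 3
  have e44 := bil hW 4 4
  have e24 := bil hW 2 4
  have e34 := bil hW 3 4
  simp [matF, w12, w13, w14] at e11 e12 e13 e14 e22 e33 e44 e24 e34
  have t4 : 8 * ((W 2 4)^2 + W 2 4 * W 3 4 + (W 3 4)^2) = (W 4 4)^2 - 1 := by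
    linear_combination -e44
  obtain ⟨q1, q2, q3⟩ := col_bound (W 2 2) (W 3 2) (W 4 2) (W 2 4) (W 3 4) (W 4 4)
    (by linear_combination -e22) t4 h2 (by linear_combination -e24)
  obtain ⟨r1, r2, r3⟩ := col_bound (W 2 3) (W 3 3) (W 4 3) (W 2 4) (W 3 4) (W 4 4)
    (by linear_combination -e33) t4 h2 (by linear_combination -e34)
  have h25 : (W 4 4)^2 ≤ 5^2 := by
    rw [← sq_abs]; exact pow_le_pow_left₀ (abs_nonneg _) h2 2
  obtain ⟨s1, s2⟩ := small (W 2 4) (W 3 4) 3 13 (by norm_num) (by linarith only [h25, t4]) (by norm_num)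
  have a1 : |W 0 1| ≤ 5000 :=
    a1_bound _ _ _ _ _ hb hi hj hk (by linear_combination e11)
  have a2 := a_bound (W 0 2) (W 1 1) (W 2 1) (W 3 1) (W 4 1) (W 2 2) (W 3 2) (W 4 2) hb
    (hi.trans (by norm_num)) (hj.trans (by norm_num)) (hk.trans (by norm_num)) q1 q2 q3 (by linear_combination e12)
  have a3 := a_bound (W 0 3) (W 1 1) (W 2 1) (W 3 1) (W 4 1) (W 2 3) (W 3 3) (W 4 3) hb
    (hi.trans (by norm_num)) (hj.trans (by norm_num)) (hk.trans (by norm_num)) r1 r2 r3 (by linear_combination e13)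
  have a4 := a_bound (W 0 4) (W 1 1) (W 2 1) (W 3 1) (W 4 1) (W 2 4) (W 3 4) (W 4 4) hb
    (hi.trans (by norm_num)) (hj.trans (by norm_num)) (hk.trans (by norm_num)) s1 s2 (h2.trans (by norm_num)) (by linear_combination e14)
  have a0 : |W 0 0| ≤ 5000 := by
    rw [v0]
    rcases Int.isUnit_iff.mp hu with h | h <;> rw [h] <;> norm_num
  have b1 : |W 1 1| ≤ 5000 := by
    rcases hb with h | h <;> rw [h] <;> norm_num
  have L : ∀ x : ℤ, |x| ≤ 13 → |x| ≤ 5000 := fun x hx => hx.trans (by norm_num)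
  have Z0 : ∀ x : ℤ, x = 0 → |x| ≤ 5000 := fun x hx => by rw [hx]; norm_num
  have R0 : ∀ m, |W 0 m| ≤ 5000 := by
    intro m
    fin_cases m
    exacts [a0, a1, a2, a3, a4]
  have R1 : ∀ m, |W 1 m| ≤ 5000 := by
    intro m
    fin_cases m
    exacts [Z0 _ v1, b1, Z0 _ w12, Z0 _ w13, Z0 _ w14]
  have R2 : ∀ m, |W 2 m| ≤ 5000 := by
    intro m
    fin_cases m
    exacts [Z0 _ v2, hi.trans (by norm_num), L _ q1, L _ r1, L _ s1]
  have R3 : ∀ m, |W 3 m| ≤ 5000 := by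
    intro m
    fin_cases m
    exacts [Z0 _ v3, hj.trans (by norm_num), L _ q2, L _ r2, L _ s2]
  have R4 : ∀ m, |W 4 m| ≤ 5000 := by
    intro m
    fin_cases m
    exacts [Z0 _ v4, hk.trans (by norm_num), L _ q3, L _ r3, h2.trans (by norm_num)]
  intro l
  fin_cases l
  exacts [R0, R1, R2, R3, R4]

lemma step3 {H : Subgroup (GL (Fin 5) ℤ)} (hH : Good H) (X : Matrix (Fin 5) (Fin 5) ℤ)
    (hX : Pres X) : ∃ M, InG H M ∧ ∀ i j, |(M * X) i j| ≤ 5000 := by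
  -- first column
  have b00 := bil hX 0 0
  obtain ⟨M1, hM1, h1⟩ := step1 hH _ (fun a => X a 0) rfl (by
    unfold Iso
    simp [matF] at b00
    linear_combination -b00)
  rw [← mul_col_apply] at h1
  have hY := hM1.1.mul hX
  set Y := M1 * X with hYdef
  have c00 := bil hY 0 0
  have c01 := bil hY 0 1
  have c02 := bil hY 0 2
  have c03 := bil hY 0 3
  have c04 := bil hY 0 4
  have c44 := bil hY 4 4
  simp [matF, h1] at c00 c01 c02 c03 c04 c44
  obtain ⟨y2, y3, y4⟩ := aniso _ (Y 2 0) (Y 3 0) (Y 4 0) rfl (by linear_combination -c00)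
  simp [y2, y3, y4] at c01 c02 c03 c04
  have hu : IsUnit (Y 0 0) := IsUnit.of_mul_eq_one (Y 1 1) (by linarith)
  have hy0 : Y 0 0 ≠ 0 := hu.ne_zero
  simp [hy0] at c02 c03 c04
  obtain ⟨M2, hM2, hf2, h2⟩ := step2 hH _ (fun a => Y a 4) rfl (by
    rw [c04] at c44
    linear_combination -c44)
  rw [← mul_col_apply] at h2
  have hZ := hM2.1.mul hY
  have z0 : ∀ i, (M2 * Y) i 0 = Y i 0 := by
    intro i
    have e : (fun a => Y a 0) = ![Y 0 0, 0, 0, 0, 0] := by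
      ext a; fin_cases a <;> simp [h1, y2, y3, y4]
    rw [mul_col_apply, e, hf2, ← e]
  set Z := M2 * Y with hZdef
  have z00 := z0 0
  have z10 := z0 1
  have z20 := z0 2
  have z30 := z0 3
  have z40 := z0 4
  rw [h1] at z10
  rw [y2] at z20
  rw [y3] at z30
  rw [y4] at z40
  have d01 := bil hZ 0 1
  have d02 := bil hZ 0 2
  have d03 := bil hZ 0 3
  have d04 := bil hZ 0 4
  simp [matF, z00, z10, z20, z30, z40, hy0] at d01 d02 d03 d04
  have hb : Z 1 1 = 1 ∨ Z 1 1 = -1 :=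
    Int.isUnit_iff.mp (IsUnit.of_mul_eq_one (Y 0 0) (by linarith))
  -- unipotent reduction
  obtain ⟨i, j, k, hi, hj, hk⟩ : ∃ i j k : ℤ, |Z 2 1 + Z 1 1 * (2*i-j)| ≤ 1 ∧
      |Z 3 1 + Z 1 1 * (2*j-i)| ≤ 1 ∧ |Z 4 1 - 12 * Z 1 1 * k| ≤ 12 := by
    obtain ⟨i, j, h1, h2, -⟩ := voronoi (Z 2 1 : ℤ) (Z 3 1 : ℤ)
    have h1' : |Z 2 1 + (2*i-j)| ≤ 1 := by exact_mod_cast h1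
    have h2' : |Z 3 1 + (2*j-i)| ≤ 1 := by exact_mod_cast h2
    have h3 : |Z 4 1 - 12 * (Z 4 1 / 12)| ≤ 12 := by
      rw [abs_le]; constructor <;> omega
    rcases hb with hb | hb
    · refine ⟨i, j, Z 4 1 / 12, ?_, ?_, ?_⟩ <;> rw [hb]
      · simpa using h1'
      · simpa using h2'
      · simpa using h3
    · refine ⟨-i, -j, -(Z 4 1 / 12), ?_, ?_, ?_⟩ <;> rw [hb]
      · convert h1' using 2; ring
      · convert h2' using 2; ring
      · convert h3 using 2; ring
  have hW := (hH.U i j k).1.mul hZ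
  have w0 : ∀ l, (matU i j k * Z) l 0 = Z l 0 := by
    intro l
    rw [mul_col_apply, U_vec]
    fin_cases l <;> simp [z10, z20, z30, z40]
  have w1 : ∀ l, (matU i j k * Z) 1 l = Z 1 l := by
    intro l
    rw [mul_col_apply, U_vec]; simp
  have w21 : (matU i j k * Z) 2 1 = Z 2 1 + Z 1 1 * (2*i-j) := by
    rw [mul_col_apply, U_vec]; simp
  have w31 : (matU i j k * Z) 3 1 = Z 3 1 + Z 1 1 * (2*j-i) := by
    rw [mul_col_apply, U_vec]; simp
  have w41 : (matU i j k * Z) 4 1 = Z 4 1 - 12 * Z 1 1 * k := by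
    rw [mul_col_apply, U_vec]; simp
  have w44 : (matU i j k * Z) 4 4 = Z 4 4 := by
    rw [mul_col_apply, U_vec]; simp [d04]
  have hfin : ∀ l m, |(matU i j k * Z) l m| ≤ 5000 := by
    have v0 := w0 0
    have v1 := w0 1
    have v2 := w0 2
    have v3 := w0 3
    have v4 := w0 4
    rw [z00] at v0
    rw [z10] at v1
    rw [z20] at v2
    rw [z30] at v3
    rw [z40] at v4
    have w11 := w1 1
    have w12 := w1 2
    have w13 := w1 3
    have w14 := w1 4
    rw [d02] at w12
    rw [d03] at w13
    rw [d04] at w14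
    rw [← w21] at hi
    rw [← w31] at hj
    rw [← w41] at hk
    rw [← w44] at h2
    rw [← w11] at hb
    exact final_bound _ hW _ hu v0 v1 v2 v3 v4 hb w12 w13 w14 hi hj hk h2
  refine ⟨matU i j k * (M2 * M1), (hH.U i j k).mul (hM2.mul hM1), ?_⟩
  rw [mul_assoc, mul_assoc, ← hYdef, ← hZdef]
  exact hfin

lemma finite_bdd (N : ℤ) :
    {M : Matrix (Fin 5) (Fin 5) ℤ | ∀ i j, |M i j| ≤ N}.Finite := by
  have h := Set.finite_Icc (fun _ _ => -N : Fin 5 → Fin 5 → ℤ) (fun _ _ => N)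
  refine Set.Finite.subset h ?_
  intro M hM
  exact ⟨fun i j => (abs_le.mp (hM i j)).1, fun i j => (abs_le.mp (hM i j)).2⟩

lemma finite_index_of_finite {G : Type*} [Group G] (K O : Subgroup G) (S : Set G) (hS : S.Finite)
    (h : ∀ g ∈ O, ∃ γ ∈ K, γ * g ∈ S) (hle : K ≤ O) : (K.subgroupOf O).FiniteIndex := by
  have hS' : {x : O | (x : G) ∈ S}.Finite := hS.preimage Subtype.val_injective.injOn
  have : Finite {x : O | (x : G) ∈ S} := hS'
  have hfin : Finite (O ⧸ K.subgroupOf O) := by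
    refine Finite.of_surjective
      (fun x : {x : O | (x : G) ∈ S} => (QuotientGroup.mk (x.1⁻¹) : O ⧸ K.subgroupOf O)) ?_
    intro y
    induction y using QuotientGroup.induction_on with
    | H g =>
      obtain ⟨γ, hγ, hs⟩ := h ((g⁻¹ : O) : G) (g⁻¹).2
      refine ⟨⟨⟨γ, hle hγ⟩ * g⁻¹, hs⟩, ?_⟩
      simp only
      rw [QuotientGroup.eq]
      simpa [Subgroup.mem_subgroupOf] using hγ
  exact Subgroup.finiteIndex_of_finite_quotient

/-- Case 9 of Theorem 1.2: the hypergeometric group `Γ(f,g)` generated by the companion matrices `A`, `B`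
of `f(x) = x^5 + x^3 - x^2 - 1` and `g(x) = x^5 + x^4 - x^3 - x^2 + x + 1`
is an arithmetic subgroup of `O_Q(ℤ)`: it preserves `Q`, it is contained in `O_Q(ℤ)`,
and it has finite index in `O_Q(ℤ)`. -/
theorem hypergeometric_group_arithmetic
    (A B : GL (Fin 5) ℤ)
    (hA : (A : Matrix (Fin 5) (Fin 5) ℤ) = matA)
    (hB : (B : Matrix (Fin 5) (Fin 5) ℤ) = matB) :
    matAᵀ * matQ * matA = matQ ∧
    matBᵀ * matQ * matB = matQ ∧
    Subgroup.closure {A, B} ≤ orthogonalSubgroup matQ ∧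
    ((Subgroup.closure {A, B}).subgroupOf (orthogonalSubgroup matQ)).FiniteIndex := by
  have eA : matAᵀ * matQ * matA = matQ := by decide +kernel
  have eB : matBᵀ * matQ * matB = matQ := by decide +kernel
  have hle : Subgroup.closure {A, B} ≤ orthogonalSubgroup matQ := by
    rw [Subgroup.closure_le]
    rintro x (rfl | rfl)
    · change (x : Matrix (Fin 5) (Fin 5) ℤ)ᵀ * matQ * (x : Matrix (Fin 5) (Fin 5) ℤ) = matQ
      rw [hA, eA]
    · change (x : Matrix (Fin 5) (Fin 5) ℤ)ᵀ * matQ * (x : Matrix (Fin 5) (Fin 5) ℤ) = matQ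
      rw [hB, eB]
  refine ⟨eA, eB, hle, ?_⟩
  have gA : InG (Subgroup.closure {A, B}) tA :=
    ⟨by unfold Pres; decide +kernel, A, Subgroup.subset_closure (by simp), by
      rw [hA]; decide +kernel⟩
  have gB : InG (Subgroup.closure {A, B}) tB :=
    ⟨by unfold Pres; decide +kernel, B, Subgroup.subset_closure (by simp), by
      rw [hB]; decide +kernel⟩
  have hgood := good gA gB
  have hinj : Function.Injective (fun g : GL (Fin 5) ℤ =>
      matT * (g : Matrix (Fin 5) (Fin 5) ℤ) * matTi) := by
    intro g g' h
    have h' : matTi * (matT * (g : Matrix (Fin 5) (Fin 5) ℤ) * matTi) * matT =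
      matTi * (matT * (g' : Matrix (Fin 5) (Fin 5) ℤ) * matTi) * matT := by
      simp only at h
      rw [h]
    have e : ∀ Y : Matrix (Fin 5) (Fin 5) ℤ, matTi * (matT * Y * matTi) * matT = Y := by
      intro Y
      calc matTi * (matT * Y * matTi) * matT = (matTi * matT) * Y * (matTi * matT) := by
            simp only [mul_assoc]
        _ = Y := by rw [Ti_T, one_mul, mul_one]
    rw [e, e] at h'
    exact Units.ext h'
  refine finite_index_of_finite _ _ _ ((finite_bdd 5000).preimage hinj.injOn) ?_ hle
  intro g hg
  have hg' : (g : Matrix (Fin 5) (Fin 5) ℤ)ᵀ * matQ * (g : Matrix (Fin 5) (Fin 5) ℤ) = matQ := hg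
  have hF : matF = matTiᵀ * matQ * matTi := by decide +kernel
  have hQ : matTᵀ * matF * matT = matQ := by decide +kernel
  have hX : Pres (matT * (g : Matrix (Fin 5) (Fin 5) ℤ) * matTi) := by
    unfold Pres
    calc (matT * (g : Matrix (Fin 5) (Fin 5) ℤ) * matTi)ᵀ * matF *
          (matT * (g : Matrix (Fin 5) (Fin 5) ℤ) * matTi)
        = matTiᵀ * ((g : Matrix (Fin 5) (Fin 5) ℤ)ᵀ * (matTᵀ * matF * matT) *
          (g : Matrix (Fin 5) (Fin 5) ℤ)) * matTi := by
          simp only [transpose_mul, mul_assoc]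
      _ = matF := by rw [hQ, hg', hF]
  obtain ⟨M, ⟨-, γ, hγ, e⟩, hM⟩ := step3 hgood _ hX
  refine ⟨γ, hγ, ?_⟩
  change ∀ i j, |(matT * ((γ * g : GL (Fin 5) ℤ) : Matrix (Fin 5) (Fin 5) ℤ) * matTi) i j| ≤ 5000
  have : matT * ((γ * g : GL (Fin 5) ℤ) : Matrix (Fin 5) (Fin 5) ℤ) * matTi =
      M * (matT * (g : Matrix (Fin 5) (Fin 5) ℤ) * matTi) := by
    rw [Units.val_mul, ← mul_assoc, e]
    simp only [mul_assoc]
  rw [this]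
  exact hM
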